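/- Let N ∈ ℕ, let J be a finite index set, and for each j ∈ J let d_j ∈ ℕ, f_j ∈ 𝓢(ℝ^{d_j}) and A_j : ℝ^N → ℝ^{d_j} a linear map, such that the intersection over j ∈ J of the kernels of the A_j equals {0}. Then the function ℝ^N → ℂ given by x ↦ Π_{j ∈ J} f_j(A_j x) belongs to 𝓢(ℝ^N). -/

import Mathlib

noncomputable section

/-- `ℝ^d`. -/
abbrev Euc (d : ℕ) : Type := EuclideanSpace ℝ (Fin d)

open Finset in
/-- A finite product of pullbacks of Schwartz functions along linear maps which are jointly
injective decays rapidly together with all its derivatives. -/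
theorem SchwartzMap.exists_pow_mul_norm_iteratedFDeriv_prod_comp_le {E : Type*}
    [NormedAddCommGroup E] [NormedSpace ℝ E] {J : Type*} [Fintype J] {F : J → Type*}
    [∀ j, NormedAddCommGroup (F j)] [∀ j, NormedSpace ℝ (F j)]
    (f : ∀ j, SchwartzMap (F j) ℂ) (A : ∀ j, E →L[ℝ] F j) {K : ℝ}
    (hA : ∀ x, ‖x‖ ≤ K * ‖fun j ↦ A j x‖) (hK : 0 ≤ K) (k n : ℕ) :
    ∃ C, ∀ x, ‖x‖ ^ k * ‖iteratedFDeriv ℝ n (fun x ↦ ∏ j, f j (A j x)) x‖ ≤ C := by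
  classical
  have hfactor (j : J) (i : ℕ) : ∃ C, ∀ x,
      (1 + ‖A j x‖) ^ k * ‖iteratedFDeriv ℝ i (fun x ↦ f j (A j x)) x‖ ≤ C := by
    refine ⟨2 ^ k * ((Iic (k, i)).sup fun m ↦ SchwartzMap.seminorm ℝ m.1 m.2) (f j) *
      ‖A j‖ ^ i, fun x ↦ ?_⟩
    have h := (A j).iteratedFDeriv_comp_right ((f j).smooth i) x (i := i) le_rfl
    have hle := ContinuousMultilinearMap.norm_compContinuousLinearMap_le
      (iteratedFDeriv ℝ i (f j) (A j x)) (fun _ : Fin i ↦ A j)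
    rw [← h, prod_const, card_univ, Fintype.card_fin] at hle
    calc _ ≤ (1 + ‖A j x‖) ^ k * (‖iteratedFDeriv ℝ i (f j) (A j x)‖ * ‖A j‖ ^ i) := by
          gcongr
          exact hle
      _ = (1 + ‖A j x‖) ^ k * ‖iteratedFDeriv ℝ i (f j) (A j x)‖ * ‖A j‖ ^ i := by ring
      _ ≤ _ := by
          refine mul_le_mul_of_nonneg_right ?_ (by positivity)
          exact SchwartzMap.one_add_le_sup_seminorm_apply (𝕜 := ℝ) (m := (k, i)) le_rfl le_rfl
            (f j) (A j x)
  choose C hC using hfactor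
  have hnorm (x : E) : ‖x‖ ≤ K * ∏ j, (1 + ‖A j x‖) := by
    refine (hA x).trans (mul_le_mul_of_nonneg_left ?_ hK)
    refine (pi_norm_le_iff_of_nonneg (by positivity)).2 fun j ↦ ?_
    calc ‖A j x‖ ≤ 1 + ‖A j x‖ := by linarith
      _ ≤ ∏ j, (1 + ‖A j x‖) := by
          rw [← mul_prod_erase univ _ (mem_univ j)]
          refine le_mul_of_one_le_right (by positivity) ?_
          exact Finset.one_le_prod fun i _ ↦ by linarith [norm_nonneg (A i x)]
  refine ⟨K ^ k * ∑ p ∈ (univ : Finset J).sym n, ((p : Multiset J).countPerms : ℝ) *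
    ∏ j, C j ((p : Multiset J).count j), fun x ↦ ?_⟩
  have hprod := norm_iteratedFDeriv_prod_le (𝕜 := ℝ) (u := univ) (n := n) (N := n)
    (f := fun j x ↦ f j (A j x)) (x := x)
    (fun j _ ↦ (((f j).smooth n).comp (A j).contDiff)) le_rfl
  calc _ ≤ (K * ∏ j, (1 + ‖A j x‖)) ^ k *
        ∑ p ∈ (univ : Finset J).sym n, ((p : Multiset J).countPerms : ℝ) *
          ∏ j, ‖iteratedFDeriv ℝ ((p : Multiset J).count j) (fun x ↦ f j (A j x)) x‖ := by
        gcongr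
        exact hnorm x
    _ = K ^ k * ∑ p ∈ (univ : Finset J).sym n, ((p : Multiset J).countPerms : ℝ) *
        ∏ j, ((1 + ‖A j x‖) ^ k *
          ‖iteratedFDeriv ℝ ((p : Multiset J).count j) (fun x ↦ f j (A j x)) x‖) := by
        simp only [prod_mul_distrib, prod_pow, mul_pow, mul_sum, mul_assoc]
        exact sum_congr rfl fun p _ ↦ by ring
    _ ≤ _ := by
        gcongr with p _ j _
        exact hC j _ x

/-- **Statement 18.** If `f_j ∈ 𝓢(ℝ^{d_j})` and `A_j : ℝ^N → ℝ^{d_j}` are linear maps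
(`j` in a finite index set) whose kernels intersect trivially, then
`x ↦ ∏_j f_j (A_j x)` belongs to `𝓢(ℝ^N)`. -/
theorem statement18 (N : ℕ) {J : Type*} [Fintype J] (d : J → ℕ)
    (f : ∀ j : J, SchwartzMap (Euc (d j)) ℂ)
    (A : ∀ j : J, Euc N →ₗ[ℝ] Euc (d j))
    (hker : ⨅ j : J, LinearMap.ker (A j) = ⊥) :
    ∃ h : SchwartzMap (Euc N) ℂ, ∀ x : Euc N, h x = ∏ j : J, f j (A j x) := by
  obtain ⟨K, -, hK⟩ := (LinearMap.pi A).exists_antilipschitzWith (by rw [LinearMap.ker_pi, hker])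
  refine ⟨⟨fun x ↦ ∏ j, f j (A j x), ?_, ?_⟩, fun x ↦ rfl⟩
  · exact contDiff_prod fun j _ ↦ ((f j).smooth _).comp (A j).toContinuousLinearMap.contDiff
  · exact SchwartzMap.exists_pow_mul_norm_iteratedFDeriv_prod_comp_le f
      (fun j ↦ (A j).toContinuousLinearMap) (K := K)
      (fun x ↦ by
        have h := hK.le_mul_dist x 0
        rwa [map_zero, dist_zero_right, dist_zero_right] at h) K.2
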